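/- (Correctness of the RETRIEVE circuit.) Let V be the two-qubit unitary on an electron qubit e (first factor) and a nuclear qubit n (second factor) given by the composition, in order of application: R_Y(π/2) on e; the electron-controlled rotation CR_X(−π/2) = |0⟩⟨0|_e⊗R_X(−π/2)_n + |1⟩⟨1|_e⊗R_X(π/2)_n; R_X(−π/2) on e; R_Z(−π/2) on n; CR_X(−π/2); and R_Z(π/2) on n. Then there exists a unit-modulus complex number λ such that for every single-qubit state |ψ⟩ ∈ ℂ², V(|0⟩ ⊗ |ψ⟩) = λ · (H|ψ⟩) ⊗ |0⟩, i.e. the circuit is the inverse of the STORE operation, moving the nuclear state onto the electron spin in the Hadamard-rotated basis. -/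

import Mathlib

open Matrix
open scoped Kronecker ComplexConjugate

noncomputable section

abbrev M2 : Type := Matrix (Fin 2) (Fin 2) ℂ

def σX : M2 := !![0, 1; 1, 0]
def σY : M2 := !![0, -Complex.I; Complex.I, 0]
def σZ : M2 := !![1, 0; 0, -1]

/-- The Hadamard gate. -/
def Hgate : M2 := (Real.sqrt 2 : ℂ)⁻¹ • !![1, 1; 1, -1]

def ket0 : Fin 2 → ℂ := ![1, 0]
def ket1 : Fin 2 → ℂ := ![0, 1]

/-- Tensor product of two single-qubit vectors. -/
def tp (v w : Fin 2 → ℂ) : Fin 2 × Fin 2 → ℂ := fun p => v p.1 * w p.2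

/-- The Bell states `|φ[s,t]⟩` for `s, t ∈ {1, -1}`:
`|φ[s,1]⟩ = (|00⟩ + s|11⟩)/√2` and `|φ[s,-1]⟩ = (|01⟩ + s|10⟩)/√2`. -/
def bell (s t : ℤ) : Fin 2 × Fin 2 → ℂ :=
  (Real.sqrt 2 : ℂ)⁻¹ •
    (if t = 1 then tp ket0 ket0 + (s : ℂ) • tp ket1 ket1
     else tp ket0 ket1 + (s : ℂ) • tp ket1 ket0)


/-- Single-qubit rotation `R_X(θ) = cos(θ/2)·I − i·sin(θ/2)·X`. -/
def RX (θ : ℝ) : M2 :=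
  (Real.cos (θ / 2) : ℂ) • (1 : M2) - (Complex.I * (Real.sin (θ / 2) : ℂ)) • σX

/-- Single-qubit rotation `R_Y(θ) = cos(θ/2)·I − i·sin(θ/2)·Y`. -/
def RY (θ : ℝ) : M2 :=
  (Real.cos (θ / 2) : ℂ) • (1 : M2) - (Complex.I * (Real.sin (θ / 2) : ℂ)) • σY

/-- Single-qubit rotation `R_Z(θ) = cos(θ/2)·I − i·sin(θ/2)·Z`. -/
def RZ (θ : ℝ) : M2 :=
  (Real.cos (θ / 2) : ℂ) • (1 : M2) - (Complex.I * (Real.sin (θ / 2) : ℂ)) • σZ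

def proj0 : M2 := !![1, 0; 0, 0]
def proj1 : M2 := !![0, 0; 0, 1]

/-- The electron-controlled rotation `CR_X(θ) = |0⟩⟨0|⊗R_X(θ) + |1⟩⟨1|⊗R_X(−θ)`
(first factor = electron, second factor = nuclear qubit). -/
def CRX (θ : ℝ) : Matrix (Fin 2 × Fin 2) (Fin 2 × Fin 2) ℂ :=
  proj0 ⊗ₖ RX θ + proj1 ⊗ₖ RX (-θ)

/-- The RETRIEVE circuit, in order of application: `R_Y(π/2)` on the electron;
`CR_X(−π/2)`; `R_X(−π/2)` on the electron; `R_Z(−π/2)` on the nuclear qubit;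
`CR_X(−π/2)`; and `R_Z(π/2)` on the nuclear qubit. -/
def retrieveCircuit : Matrix (Fin 2 × Fin 2) (Fin 2 × Fin 2) ℂ :=
  ((1 : M2) ⊗ₖ RZ (Real.pi / 2)) * CRX (-(Real.pi / 2)) * ((1 : M2) ⊗ₖ RZ (-(Real.pi / 2))) *
    (RX (-(Real.pi / 2)) ⊗ₖ (1 : M2)) * CRX (-(Real.pi / 2)) * (RY (Real.pi / 2) ⊗ₖ (1 : M2))

theorem RX_pi_div_two :
    RX (Real.pi / 2) = (Real.sqrt 2 / 2 : ℂ) • !![1, -Complex.I; -Complex.I, 1] := by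
  ext i j
  fin_cases i <;> fin_cases j <;>
    simp [RX, σX, show Real.pi / 2 / 2 = Real.pi / 4 by ring, -Complex.ofReal_cos,
      -Complex.ofReal_sin] <;> ring

theorem RX_neg_pi_div_two :
    RX (-(Real.pi / 2)) = (Real.sqrt 2 / 2 : ℂ) • !![1, Complex.I; Complex.I, 1] := by
  ext i j
  fin_cases i <;> fin_cases j <;>
    simp [RX, σX, show -(Real.pi / 2) / 2 = -(Real.pi / 4) by ring, -Complex.ofReal_cos,
      -Complex.ofReal_sin] <;> ring

theorem RY_pi_div_two :
    RY (Real.pi / 2) = (Real.sqrt 2 / 2 : ℂ) • !![1, -1; 1, 1] := by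
  ext i j
  fin_cases i <;> fin_cases j <;>
    simp [RY, σY, show Real.pi / 2 / 2 = Real.pi / 4 by ring, -Complex.ofReal_cos,
      -Complex.ofReal_sin] <;> grind [Complex.I_mul_I]

theorem RZ_pi_div_two :
    RZ (Real.pi / 2) = (Real.sqrt 2 / 2 : ℂ) • !![1 - Complex.I, 0; 0, 1 + Complex.I] := by
  ext i j
  fin_cases i <;> fin_cases j <;>
    simp [RZ, σZ, show Real.pi / 2 / 2 = Real.pi / 4 by ring, -Complex.ofReal_cos,
      -Complex.ofReal_sin] <;> ring

theorem RZ_neg_pi_div_two :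
    RZ (-(Real.pi / 2)) = (Real.sqrt 2 / 2 : ℂ) • !![1 + Complex.I, 0; 0, 1 - Complex.I] := by
  ext i j
  fin_cases i <;> fin_cases j <;>
    simp [RZ, σZ, show -(Real.pi / 2) / 2 = -(Real.pi / 4) by ring, -Complex.ofReal_cos,
      -Complex.ofReal_sin] <;> ring

/-- Correctness of the RETRIEVE circuit: there is a unit-modulus `λ` such that for every
single-qubit state `|ψ⟩`, `V(|0⟩ ⊗ |ψ⟩) = λ · (H|ψ⟩) ⊗ |0⟩`. -/
theorem retrieve_circuit_correct :
    ∃ lam : ℂ, ‖lam‖ = 1 ∧ ∀ ψ : Fin 2 → ℂ,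
      retrieveCircuit.mulVec (tp ket0 ψ) = lam • tp (Hgate.mulVec ψ) ket0 := by
  have hs : (Real.sqrt 2 : ℂ) ^ 2 = 2 := by
    rw [← Complex.ofReal_pow, Real.sq_sqrt zero_le_two, Complex.ofReal_ofNat]
  have hI : Complex.I ^ 2 = -1 := Complex.I_sq
  have hinv : (Real.sqrt 2 : ℂ)⁻¹ = Real.sqrt 2 / 2 := by
    have h0 : (Real.sqrt 2 : ℂ) ≠ 0 := by
      intro h
      simp [h] at hs
    field_simp
    exact hs.symm
  refine ⟨Real.sqrt 2 / 2 * (1 + Complex.I), ?_, fun ψ => ?_⟩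
  · have h : ‖(1 + Complex.I : ℂ)‖ = Real.sqrt 2 := by
      rw [Complex.norm_eq_sqrt_sq_add_sq]
      norm_num
    rw [norm_mul, h, norm_div, Complex.norm_real, Real.norm_of_nonneg (Real.sqrt_nonneg 2),
      Complex.norm_ofNat, div_mul_eq_mul_div, Real.mul_self_sqrt zero_le_two, div_self two_ne_zero]
  · simp only [retrieveCircuit, CRX, neg_neg, RX_pi_div_two, RX_neg_pi_div_two, RY_pi_div_two,
      RZ_pi_div_two, RZ_neg_pi_div_two, Hgate, hinv, ← mulVec_mulVec]
    generalize (Real.sqrt 2 : ℂ) = s at hs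
    generalize Complex.I = I at hI
    ext ⟨i, j⟩
    fin_cases i <;> fin_cases j <;>
      simp [mulVec, dotProduct, Fintype.sum_prod_type, tp, ket0, proj0, proj1,
        kroneckerMap_apply] <;>
      grind
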